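/- Let S(x²p) = (1/3)(x̂² p̂ + x̂ p̂ x̂ + p̂ x̂²) and S(xp²) = (1/3)(x̂ p̂² + p̂ x̂ p̂ + p̂² x̂) be the symmetrized (Weyl) quantizations of x²p and xp². Then the operator identity (1/(3iℏ)) [S(x²p), S(xp²)] = x̂² p̂² − 2iℏ x̂ p̂ − (1/3)ℏ²·id holds on 𝒮(ℝ, ℂ). (This is the quantization of x²p² obtained from the Poisson bracket {x²p, xp²} = 3 x²p² via the Dirac correspondence, and it conflicts with the value (1/(9iℏ))[x̂³, p̂³] = x̂²p̂² − 2iℏx̂p̂ − (2/3)ℏ², illustrating the Groenewold–van Hove obstruction.) -/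

import Mathlib

open SchwartzMap

/-- Elements `X`, `P` of a complex algebra with `[X, P] = c` satisfy
`(1/(3c))[S(x²p), S(xp²)] = x²p² − 2c xp + (1/3)c²`, where `S` is symmetrization. -/
theorem symmetrized_commutator_of_ccr {A : Type*} [Ring A] [Algebra ℂ A] {c : ℂ} (hc : c ≠ 0)
    {X P : A} (h : X * P - P * X = c • (1 : A)) :
    (1 / (3 * c)) • (((1 / 3 : ℂ) • (X ^ 2 * P + X * P * X + P * X ^ 2)) *
        ((1 / 3 : ℂ) • (X * P ^ 2 + P * X * P + P ^ 2 * X)) -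
      ((1 / 3 : ℂ) • (X * P ^ 2 + P * X * P + P ^ 2 * X)) *
        ((1 / 3 : ℂ) • (X ^ 2 * P + X * P * X + P * X ^ 2))) =
      X ^ 2 * P ^ 2 - (2 * c) • (X * P) + ((1 / 3 : ℂ) * c ^ 2) • (1 : A) := by
  have hPX : P * X = X * P - c • (1 : A) := by rw [← h]; abel
  have hPXZ : ∀ Z : A, P * (X * Z) = X * (P * Z) - c • Z := fun Z => by
    rw [← mul_assoc, hPX, sub_mul, mul_assoc, smul_mul_assoc, one_mul]
  have h₁ : (1 / 3 : ℂ) • (X ^ 2 * P + X * P * X + P * X ^ 2) = X * (X * P) - c • X := by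
    simp only [pow_two, mul_assoc, hPX, hPXZ, mul_sub, mul_smul_comm, mul_one]
    module
  have h₂ : (1 / 3 : ℂ) • (X * P ^ 2 + P * X * P + P ^ 2 * X) = X * (P * P) - c • P := by
    simp only [pow_two, mul_assoc, hPX, hPXZ, mul_sub, sub_mul, mul_smul_comm, smul_mul_assoc,
      mul_one, one_mul]
    module
  rw [h₁, h₂]
  simp only [pow_two, mul_assoc, hPX, hPXZ, mul_sub, sub_mul, mul_smul_comm, smul_mul_assoc,
    mul_one, smul_sub]
  match_scalars <;> field_simp <;> ring

/-- The canonical commutation relation `[x̂, p̂] = iℏ` on Schwartz space. -/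
theorem SchwartzMap.position_momentum_commutator (ℏ : ℝ)
    (X P : 𝓢(ℝ, ℂ) →L[ℂ] 𝓢(ℝ, ℂ))
    (hX : ∀ (f : 𝓢(ℝ, ℂ)) (x : ℝ), X f x = x * f x)
    (hP : ∀ (f : 𝓢(ℝ, ℂ)) (x : ℝ), P f x = -(Complex.I * ℏ) * deriv (⇑f) x) :
    X * P - P * X = (Complex.I * (ℏ : ℂ)) • (1 : 𝓢(ℝ, ℂ) →L[ℂ] 𝓢(ℝ, ℂ)) := by
  ext f x
  have hXf : ⇑(X f) = fun y : ℝ => (y : ℂ) * f y := funext (hX f)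
  have hd : deriv (fun y : ℝ => (y : ℂ) * f y) x = 1 * f x + x * deriv (⇑f) x :=
    ((Complex.ofRealCLM.hasDerivAt (x := x)).mul f.differentiableAt.hasDerivAt).deriv
  change X (P f) x - P (X f) x = (Complex.I * (ℏ : ℂ)) * f x
  rw [hX, hP, hP, hXf, hd]
  ring

set_option synthInstance.maxHeartbeats 1000000 in
/-- With `S(x²p) = (1/3)(x̂²p̂ + x̂p̂x̂ + p̂x̂²)` and `S(xp²) = (1/3)(x̂p̂² + p̂x̂p̂ + p̂²x̂)`,
the identity `(1/(3iℏ))[S(x²p), S(xp²)] = x̂²p̂² − 2iℏ x̂p̂ − (1/3)ℏ²·id` holds. -/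
theorem symmetrized_commutator_identity (ℏ : ℝ) (hℏ : 0 < ℏ)
    (X P : 𝓢(ℝ, ℂ) →L[ℂ] 𝓢(ℝ, ℂ))
    (hX : ∀ (f : 𝓢(ℝ, ℂ)) (x : ℝ), X f x = x * f x)
    (hP : ∀ (f : 𝓢(ℝ, ℂ)) (x : ℝ), P f x = -(Complex.I * ℏ) * deriv (⇑f) x)
    (S₁ S₂ : 𝓢(ℝ, ℂ) →L[ℂ] 𝓢(ℝ, ℂ))
    (hS₁ : S₁ = (1 / 3 : ℂ) • (X ^ 2 * P + X * P * X + P * X ^ 2))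
    (hS₂ : S₂ = (1 / 3 : ℂ) • (X * P ^ 2 + P * X * P + P ^ 2 * X)) :
    (1 / (3 * Complex.I * (ℏ : ℂ))) • (S₁ * S₂ - S₂ * S₁) =
      X ^ 2 * P ^ 2 - (2 * Complex.I * (ℏ : ℂ)) • (X * P) -
        ((1 / 3 : ℂ) * (ℏ : ℂ) ^ 2) • (1 : 𝓢(ℝ, ℂ) →L[ℂ] 𝓢(ℝ, ℂ)) := by
  subst hS₁ hS₂
  have hc : Complex.I * (ℏ : ℂ) ≠ 0 :=
    mul_ne_zero Complex.I_ne_zero (Complex.ofReal_ne_zero.mpr hℏ.ne')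
  have key := symmetrized_commutator_of_ccr hc
    (SchwartzMap.position_momentum_commutator ℏ X P hX hP)
  rw [← mul_assoc, ← mul_assoc, mul_pow, Complex.I_sq] at key
  rw [key, sub_eq_add_neg _ (((1 / 3 : ℂ) * (ℏ : ℂ) ^ 2) • _), ← neg_smul]
  congr 2
  ring
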